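/- arXiv:1309.4968 — 2 statements merged into one kernel-verified Lean document; each statement's English description precedes it below -/
import Mathlib

section
/- Let q ∈ ℂ with q ≠ 0, let j ≥ 0 be an integer with q^m ≠ 1 for all integers 1 ≤ m ≤ j, and let z ∈ ℂ satisfy z + [m]_{q⁻¹} ≠ 0 for all integers 1 ≤ m ≤ 2j−1. Then for all integers n with 0 ≤ j ≤ n: JS_n^j(z;q) = Σ_{r=0}^{j} (−1)^{j−r} · q^{−r(r−1)/2 − r(j−r)} · ([r]_q·([r]_{q⁻¹} + z))^{n} / ( [r]_q! · [j−r]_q! · ∏_{0 ≤ k ≤ j, k ≠ r} (z + [k+r]_{q⁻¹}) ). -/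
/-- `[n]_q := ∑_{i=0}^{n-1} q^i`. -/
noncomputable def qint (q : ℂ) (n : ℕ) : ℂ := ∑ i ∈ Finset.range n, q ^ i

/-- `∏_{i=0}^{k-1}(x - [i]_q(z + [i]_{q⁻¹}))`, the basis defining the
`q`-Jacobi-Stirling numbers. -/
noncomputable def jsPoly (q z : ℂ) (k : ℕ) : Polynomial ℂ :=
  ∏ i ∈ Finset.range k, (Polynomial.X - Polynomial.C (qint q i * (z + qint q⁻¹ i)))

/-- `[n]_q! := ∏_{i=1}^{n} [i]_q`. -/
noncomputable def qfact (q : ℂ) (n : ℕ) : ℂ := ∏ i ∈ Finset.range n, qint q (i + 1)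

theorem aux_diff (q z : ℂ) (hq : q ≠ 0) (h1 : q ≠ 1) (k d : ℕ) :
    qint q (k + d) * (z + qint q⁻¹ (k + d)) - qint q k * (z + qint q⁻¹ k)
      = q ^ k * qint q d * (z + qint q⁻¹ (k + (k + d))) := by
  have e : ∀ n, qint q n = (q ^ n - 1) / (q - 1) := fun n => geom_sum_eq h1 n
  have h1' : q⁻¹ ≠ 1 := by simpa using h1
  have e' : ∀ n, qint q⁻¹ n = q * (1 - (q ^ n)⁻¹) / (q - 1) := by
    intro n
    have := geom_sum_eq h1' n
    unfold qint
    rw [this, inv_pow]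
    have a1 : q - 1 ≠ 0 := sub_ne_zero.mpr h1
    have a2 : q⁻¹ - 1 ≠ 0 := sub_ne_zero.mpr h1'
    rw [div_eq_div_iff a2 a1]
    field_simp
    ring
  simp only [e, e']
  have a1 : q - 1 ≠ 0 := sub_ne_zero.mpr h1
  have hk : q ^ k ≠ 0 := pow_ne_zero _ hq
  have hd : q ^ d ≠ 0 := pow_ne_zero _ hq
  simp only [pow_add]
  generalize q ^ k = K at *
  generalize q ^ d = D at *
  field_simp
  ring

theorem aux_prod (q z : ℂ) (hq : q ≠ 0) (r s : ℕ) (h1 : 1 ≤ r + s → q ≠ 1) :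
    ∏ k ∈ (Finset.range (r + s + 1)).erase r,
        (qint q r * (z + qint q⁻¹ r) - qint q k * (z + qint q⁻¹ k))
      = (-1 : ℂ) ^ s * q ^ (r * (r - 1) / 2 + r * s) * (qfact q r * qfact q s *
          ∏ k ∈ (Finset.range (r + s + 1)).erase r, (z + qint q⁻¹ (k + r))) := by
  induction s with
  | zero =>
    have e : (Finset.range (r + 0 + 1)).erase r = Finset.range r := by
      ext x; simp; omega
    rw [e]
    have : ∀ k ∈ Finset.range r,
        (qint q r * (z + qint q⁻¹ r) - qint q k * (z + qint q⁻¹ k))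
        = q ^ k * qint q (r - 1 - k + 1) * (z + qint q⁻¹ (k + r)) := by
      intro k hk
      have hk := Finset.mem_range.mp hk
      have := aux_diff q z hq (h1 (by omega)) k (r - 1 - k + 1)
      rwa [show k + (r - 1 - k + 1) = r by omega] at this
    rw [Finset.prod_congr rfl this, Finset.prod_mul_distrib, Finset.prod_mul_distrib,
      Finset.prod_pow_eq_pow_sum, Finset.sum_range_id,
      Finset.prod_range_reflect (fun i => qint q (i + 1)) r]
    simp [qfact]
    ring
  | succ s ih =>
    have e : (Finset.range (r + (s + 1) + 1)).erase r
        = insert (r + s + 1) ((Finset.range (r + s + 1)).erase r) := by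
      ext x; simp; omega
    have hn : r + s + 1 ∉ (Finset.range (r + s + 1)).erase r := by simp
    have hd := aux_diff q z hq (h1 (by omega)) r (s + 1)
    rw [e, Finset.prod_insert hn, Finset.prod_insert hn, ih (fun _ => h1 (by omega)),
      show qfact q (s + 1) = qfact q s * qint q (s + 1) from Finset.prod_range_succ _ _]
    have hd' : qint q r * (z + qint q⁻¹ r) - qint q (r + s + 1) * (z + qint q⁻¹ (r + s + 1))
       = - (q ^ r * qint q (s + 1) * (z + qint q⁻¹ (r + s + 1 + r))) := by
      rw [show r + s + 1 + r = r + (r + (s + 1)) by ring, ← hd]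
      simp only [← add_assoc]
      ring
    rw [hd', show r * (s + 1) = r * s + r by ring, ← add_assoc, pow_add q _ r]
    ring

theorem aux_js_monic (q z : ℂ) (k : ℕ) : (jsPoly q z k).Monic :=
  Polynomial.monic_prod_of_monic _ _ fun _ _ => Polynomial.monic_X_sub_C _

theorem aux_js_deg (q z : ℂ) (k : ℕ) : (jsPoly q z k).natDegree = k := by
  unfold jsPoly
  rw [Polynomial.natDegree_prod_of_monic _ _ fun _ _ => Polynomial.monic_X_sub_C _]
  simp only [Polynomial.natDegree_X_sub_C]
  simp

theorem aux_L (q z : ℂ) (j k : ℕ)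
    (hinj : Set.InjOn (fun i => qint q i * (z + qint q⁻¹ i)) (Finset.range (j + 1))) :
    ∑ r ∈ Finset.range (j + 1), (jsPoly q z k).eval (qint q r * (z + qint q⁻¹ r)) /
      ∏ i ∈ (Finset.range (j + 1)).erase r,
        (qint q r * (z + qint q⁻¹ r) - qint q i * (z + qint q⁻¹ i))
      = if k = j then 1 else 0 := by
  by_cases hk : k ≤ j
  · have hd : (jsPoly q z k).degree < ((Finset.range (j + 1)).card : ℕ) := by
      rw [Polynomial.degree_eq_natDegree (aux_js_monic q z k).ne_zero, aux_js_deg,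
        Finset.card_range]
      exact_mod_cast Nat.lt_succ_of_le hk
    have := Lagrange.coeff_eq_sum hinj hd
    rw [← this, Finset.card_range, Nat.add_sub_cancel]
    split_ifs with h
    · subst h
      have := (aux_js_monic q z k).coeff_natDegree
      rwa [aux_js_deg] at this
    · apply Polynomial.coeff_eq_zero_of_natDegree_lt
      rw [aux_js_deg]; omega
  · rw [if_neg (by omega)]
    apply Finset.sum_eq_zero
    intro r hr
    have hr := Finset.mem_range.mp hr
    have : (jsPoly q z k).eval (qint q r * (z + qint q⁻¹ r)) = 0 := by
      unfold jsPoly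
      rw [Polynomial.eval_prod]
      exact Finset.prod_eq_zero (Finset.mem_range.mpr (by omega : r < k)) (by simp)
    rw [this, zero_div]

/-- explicit formula for the `q`-Jacobi-Stirling numbers of the second
kind, formula (2.13) of the paper. -/
theorem statement9 (q : ℂ) (hq : q ≠ 0) (j : ℕ)
    (hqj : ∀ m : ℕ, 1 ≤ m → m ≤ j → q ^ m ≠ 1)
    (z : ℂ) (hz : ∀ m : ℕ, 1 ≤ m → m ≤ 2 * j - 1 → z + qint q⁻¹ m ≠ 0)
    (JS : ℕ → ℕ → ℂ)
    (hJS : ∀ m : ℕ, (Polynomial.X : Polynomial ℂ) ^ m =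
      ∑ k ∈ Finset.range (m + 1), Polynomial.C (JS m k) * jsPoly q z k) :
    ∀ n : ℕ, j ≤ n →
      JS n j = ∑ r ∈ Finset.range (j + 1),
        (-1 : ℂ) ^ (j - r) *
          (q ^ (-((r * (r - 1) / 2 + r * (j - r) : ℕ) : ℤ)) *
            (qint q r * (qint q⁻¹ r + z)) ^ n) /
          (qfact q r * qfact q (j - r) *
            ∏ k ∈ (Finset.range (j + 1)).erase r, (z + qint q⁻¹ (k + r))) := by
  have hq1 : 1 ≤ j → q ≠ 1 := fun h => by simpa using hqj 1 le_rfl h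
  have hlt : ∀ a b : ℕ, a < b → b ≤ j →
      qint q a * (z + qint q⁻¹ a) ≠ qint q b * (z + qint q⁻¹ b) := by
    intro a b hab hb heq
    have h1 := hq1 (by omega)
    have hd := aux_diff q z hq h1 a (b - a)
    rw [show a + (b - a) = b by omega, heq, sub_self] at hd
    have hqi : qint q (b - a) ≠ 0 := by
      have : qint q (b - a) = _ := geom_sum_eq h1 (b - a)
      rw [this]
      exact div_ne_zero (sub_ne_zero.mpr (hqj _ (by omega) (by omega))) (sub_ne_zero.mpr h1)
    exact mul_ne_zero (mul_ne_zero (pow_ne_zero _ hq) hqi)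
      (hz (a + b) (by omega) (by omega)) hd.symm
  have hinj : Set.InjOn (fun i => qint q i * (z + qint q⁻¹ i)) (Finset.range (j + 1)) := by
    intro a ha b hb hab
    have ha : a < j + 1 := by simpa using ha
    have hb : b < j + 1 := by simpa using hb
    rcases lt_trichotomy a b with h | h | h
    · exact absurd hab (hlt a b h (by omega))
    · exact h
    · exact absurd hab.symm (hlt b a h (by omega))
  intro n hn
  have key : ∑ r ∈ Finset.range (j + 1), (qint q r * (z + qint q⁻¹ r)) ^ n /
      ∏ i ∈ (Finset.range (j + 1)).erase r,
        (qint q r * (z + qint q⁻¹ r) - qint q i * (z + qint q⁻¹ i)) = JS n j := by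
    have hev : ∀ x : ℂ, x ^ n = ∑ k ∈ Finset.range (n + 1), JS n k * (jsPoly q z k).eval x := by
      intro x
      have := congrArg (Polynomial.eval x) (hJS n)
      simpa [Polynomial.eval_finsetSum] using this
    simp_rw [hev, Finset.sum_div]
    rw [Finset.sum_comm]
    simp_rw [mul_div_assoc, ← Finset.mul_sum, aux_L q z j _ hinj]
    simp
    intro h
    omega
  rw [← key]
  apply Finset.sum_congr rfl
  intro r hr
  have hr := Finset.mem_range.mp hr
  obtain ⟨s, rfl⟩ : ∃ s, j = r + s := ⟨j - r, by omega⟩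
  rw [aux_prod q z hq r s hq1, Nat.add_sub_cancel_left, zpow_neg, zpow_natCast,
    add_comm (qint q⁻¹ r) z]
  have hs : ((-1 : ℂ) ^ s)⁻¹ = (-1) ^ s := by
    rw [← inv_pow]; norm_num
  rw [div_eq_mul_inv, div_eq_mul_inv, mul_inv, mul_inv ((-1 : ℂ) ^ s), hs]
  ring
end

section
/- For all complex numbers z, w and all integers 0 ≤ k ≤ n: S_{z,w}(n,k) = Σ_{π ∈ Π(n,k)} z^{s(π)}·w^{t(π)}, the sum over all double signed k-partitions π of [n]_2, where s(π) is the number of subscript-1 elements in the zero block B_0 of π and t(π) is the number of subscript-2 elements in the zero block B_0' of π. -/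
open scoped Classical

/-- `∏_{i=0}^{k-1}(x - (i+z)(i+w))`, the basis defining the symmetric generalisation
`S_{z,w}(n,k)` of the Jacobi-Stirling numbers. -/
noncomputable def zwPoly (z w : ℂ) (k : ℕ) : Polynomial ℂ :=
  ∏ i ∈ Finset.range k, (Polynomial.X - Polynomial.C (((i : ℂ) + z) * ((i : ℂ) + w)))

/-- A double signed `k`-partition of `[n]₂` is encoded as the assignment
`f : Fin n × Bool → Fin (k+2)` sending each copy (`false` = subscript 1, `true` =
subscript 2) of each number `a+1`, `a : Fin n`, to the index of its block; block `0` is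
`B₀`, block `1` is `B₀'`, and the nonzero blocks (indices `≥ 2`) are listed in increasing
order of their minima. -/
def IsDoubleSignedPartition (n k : ℕ) (f : Fin n × Bool → Fin (k + 2)) : Prop :=
  -- the zero block `B₀` does not contain both copies of any number
  (∀ a : Fin n, ¬(f (a, false) = 0 ∧ f (a, true) = 0)) ∧
  -- `B₀'` may contain only numbers with subscript 2
  (∀ a : Fin n, f (a, false) ≠ 1) ∧
  -- each nonzero block is nonempty and contains both copies of its smallest number
  (∀ j : Fin (k + 2), j ≠ 0 → j ≠ 1 →
    ∃ m : Fin n, f (m, false) = j ∧ f (m, true) = j ∧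
      ∀ a : Fin n, (f (a, false) = j ∨ f (a, true) = j) → m ≤ a) ∧
  -- each nonzero block contains at most one copy of any number other than its minimum
  (∀ j : Fin (k + 2), j ≠ 0 → j ≠ 1 →
    ∀ a : Fin n, f (a, false) = j → f (a, true) = j →
      ∀ b : Fin n, (f (b, false) = j ∨ f (b, true) = j) → a ≤ b) ∧
  -- the nonzero blocks are indexed in increasing order of their minima
  (∀ j j' : Fin (k + 2), j ≠ 0 → j ≠ 1 → j' ≠ 0 → j' ≠ 1 → j < j' →
    ∀ m m' : Fin n,
      (f (m, false) = j ∧ f (m, true) = j) →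
      (f (m', false) = j' ∧ f (m', true) = j') → m < m')

/-- `s(π)`: the number of subscript-1 elements in `B₀`. -/
noncomputable def sStat (n k : ℕ) (f : Fin n × Bool → Fin (k + 2)) : ℕ :=
  (Finset.univ.filter fun a : Fin n => f (a, false) = 0).card

/-- `t(π)`: the number of subscript-2 elements in `B₀'`. -/
noncomputable def tStat (n k : ℕ) (f : Fin n × Bool → Fin (k + 2)) : ℕ :=
  (Finset.univ.filter fun a : Fin n => f (a, true) = 1).card

noncomputable def extF {n : ℕ} {α : Type} (g : Fin n × Bool → α) (a b : α) : Fin (n + 1) × Bool → α :=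
  fun p => Fin.lastCases (motive := fun _ => α) (if p.2 then b else a) (fun i => g (i, p.2)) p.1

lemma extF_cast {n : ℕ} {α : Type} (g : Fin n × Bool → α) (a b : α) (i : Fin n) (c : Bool) :
    extF g a b (i.castSucc, c) = g (i, c) := by simp [extF]

lemma extF_false {n : ℕ} {α : Type} (g : Fin n × Bool → α) (a b : α) :
    extF g a b (Fin.last n, false) = a := by simp [extF]

lemma extF_true {n : ℕ} {α : Type} (g : Fin n × Bool → α) (a b : α) :
    extF g a b (Fin.last n, true) = b := by simp [extF]

noncomputable def extEquiv (n : ℕ) (α : Type) :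
    ((Fin n × Bool → α) × α × α) ≃ (Fin (n + 1) × Bool → α) where
  toFun q := extF q.1 q.2.1 q.2.2
  invFun f := (fun p => f (p.1.castSucc, p.2), f (Fin.last n, false), f (Fin.last n, true))
  left_inv q := by
    simp only [extF_cast, extF_false, extF_true]
  right_inv f := by
    funext ⟨i, c⟩
    induction i using Fin.lastCases with
    | last => cases c <;> simp [extF_false, extF_true]
    | cast i => simp [extF_cast]

noncomputable def wt (z w : ℂ) (n k : ℕ) (f : Fin n × Bool → Fin (k + 2)) : ℂ :=
  z ^ sStat n k f * w ^ tStat n k f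

noncomputable def TT (z w : ℂ) (n k : ℕ) : ℂ :=
  ∑ f : Fin n × Bool → Fin (k + 2), if IsDoubleSignedPartition n k f then wt z w n k f else 0

lemma wt_eq (z w : ℂ) (n k : ℕ) (f : Fin n × Bool → Fin (k + 2)) :
    wt z w n k f = ∏ i : Fin n, ((if f (i, false) = 0 then z else 1) *
      (if f (i, true) = 1 then w else 1)) := by
  rw [Finset.prod_mul_distrib, Finset.prod_ite, Finset.prod_ite]
  simp [wt, sStat, tStat]

lemma wt_ext (z w : ℂ) (n k : ℕ) (g : Fin n × Bool → Fin (k + 2)) (a b : Fin (k + 2)) :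
    wt z w (n + 1) k (extF g a b) = wt z w n k g *
      ((if a = 0 then z else 1) * (if b = 1 then w else 1)) := by
  rw [wt_eq, wt_eq, Fin.prod_univ_castSucc]
  simp only [extF_cast, extF_false, extF_true]

lemma part_ext_ne (n k : ℕ) (g : Fin n × Bool → Fin (k + 2)) (a b : Fin (k + 2)) (hab : a ≠ b) :
    IsDoubleSignedPartition (n + 1) k (extF g a b) ↔ (IsDoubleSignedPartition n k g ∧ a ≠ 1) := by
  have key : ∀ j, a = j → b = j → False := fun j h1 h2 => hab (h1.trans h2.symm)
  have key' : ∀ j, ¬ (a = j ∧ b = j) := fun j h => hab (h.1.trans h.2.symm)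
  have key2 : ∀ j (p : Prop), ¬ (a = j ∧ b = j ∧ p) := fun j p h => hab (h.1.trans h.2.1.symm)
  have e3 : ∀ j (p : Prop), (a = j → b = j → p) ↔ True :=
    fun j p => ⟨fun _ => trivial, fun _ h1 h2 => (key j h1 h2).elim⟩
  unfold IsDoubleSignedPartition
  simp only [Fin.forall_fin_succ', Fin.exists_fin_succ', extF_cast, extF_false, extF_true, key', key2, e3,
    Fin.castSucc_le_castSucc_iff, Fin.castSucc_lt_castSucc_iff, Fin.le_last, implies_true, and_true,
    or_false, not_false_eq_true, false_implies]
  tauto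

lemma part_ext_eq (n k : ℕ) (g : Fin n × Bool → Fin (k + 2)) (a : Fin (k + 2))
    (h : IsDoubleSignedPartition (n + 1) k (extF g a a)) :
    a = Fin.last (k + 1) ∧ a ≠ 0 ∧ a ≠ 1 ∧ ∀ p, g p ≠ Fin.last (k + 1) := by
  obtain ⟨h1, h2, h3, h4, h5⟩ := h
  have a0 : a ≠ 0 := by
    have := h1 (Fin.last n)
    simpa only [extF_false, extF_true, and_self] using this
  have a1 : a ≠ 1 := by
    have := h2 (Fin.last n)
    simpa only [extF_false] using this
  have hl : a = Fin.last (k + 1) := by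
    by_contra hne
    have hlt : a < Fin.last (k + 1) := Fin.lt_last_iff_ne_last.2 hne
    have l0 : Fin.last (k + 1) ≠ 0 := by
      intro h; rw [h] at hlt; exact absurd hlt (Fin.not_lt_zero _)
    have l1 : Fin.last (k + 1) ≠ 1 := by
      intro h; rw [h] at hlt
      exact a0 (by have := Fin.lt_def.1 hlt; apply Fin.ext; simp at this ⊢; omega)
    obtain ⟨m, hm1, hm2, -⟩ := h3 _ l0 l1
    have := h5 a _ a0 a1 l0 l1 hlt (Fin.last n) m ⟨extF_false _ _ _, extF_true _ _ _⟩ ⟨hm1, hm2⟩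
    exact absurd this (not_lt.2 (Fin.le_last _))
  refine ⟨hl, a0, a1, ?_⟩
  rintro ⟨i, c⟩ hi
  have := h4 a a0 a1 (Fin.last n) (extF_false _ _ _) (extF_true _ _ _) i.castSucc
    (by rw [extF_cast, extF_cast, hl]; cases c
        · exact Or.inl hi
        · exact Or.inr hi)
  exact absurd this (not_le.2 (Fin.castSucc_lt_last i))

lemma cs0 {k : ℕ} (x : Fin (k + 2)) : x.castSucc = (0 : Fin (k + 3)) ↔ x = 0 := by
  rw [← Fin.castSucc_zero, Fin.castSucc_inj]

lemma cs1 {k : ℕ} (x : Fin (k + 2)) : x.castSucc = (1 : Fin (k + 3)) ↔ x = 1 := by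
  rw [← Fin.castSucc_one, Fin.castSucc_inj]

lemma part_ext_last (n k : ℕ) (g : Fin n × Bool → Fin (k + 2)) :
    IsDoubleSignedPartition (n + 1) (k + 1)
      (extF (fun p => (g p).castSucc) (Fin.last (k + 2)) (Fin.last (k + 2))) ↔
    IsDoubleSignedPartition n k g := by
  have c0 : ∀ x : Fin (k + 2), x.castSucc = (0 : Fin (k + 3)) ↔ x = 0 := by
    intro x; exact cs0 x
  have c1 : ∀ x : Fin (k + 2), x.castSucc = (1 : Fin (k + 3)) ↔ x = 1 := by
    intro x; exact cs1 x
  have l0 : (Fin.last (k + 2) : Fin (k + 3)) ≠ 0 := by simp [Fin.ext_iff]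
  have l1 : (Fin.last (k + 2) : Fin (k + 3)) ≠ 1 := by simp [Fin.ext_iff]
  have cl : ∀ x : Fin (k + 2), x.castSucc ≠ Fin.last (k + 2) := fun x => Fin.castSucc_ne_last x
  have lc : ∀ x : Fin (k + 2), Fin.last (k + 2) ≠ x.castSucc := fun x => (Fin.castSucc_ne_last x).symm
  have ll : ∀ x : Fin (k + 2), ¬ (Fin.last (k + 2) < x.castSucc) := fun x => not_lt.2 (Fin.le_last _)
  have cll : ∀ i : Fin n, ¬ (Fin.last n ≤ i.castSucc) := fun x => not_le.2 (Fin.castSucc_lt_last _)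
  unfold IsDoubleSignedPartition
  simp only [Fin.forall_fin_succ' (n := n), Fin.exists_fin_succ' (n := n), Fin.forall_fin_succ' (n := k + 2),
    extF_cast, extF_false, extF_true, ne_eq, c0, c1, l0, l1, cl, lc, ll, cll,
    Fin.castSucc_inj, Fin.castSucc_lt_last,
    Fin.castSucc_le_castSucc_iff, Fin.castSucc_lt_castSucc_iff, Fin.le_last, implies_true, and_true, true_and,
    or_false, not_false_eq_true, false_implies, lt_irrefl, and_self, or_self, false_and, and_false,
    exists_false, false_or, forall_const, true_implies, le_refl]

lemma sum_ab (z w : ℂ) (k : ℕ) :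
    ∑ a : Fin (k + 2), ∑ b : Fin (k + 2), (if a ≠ b ∧ a ≠ 1 then
      (if a = 0 then z else 1) * (if b = 1 then w else 1) else 0) = ((k : ℂ) + z) * (k + w) := by
  have hb : ∑ b : Fin (k + 2), (if b = 1 then w else 1) = k + 1 + w := by
    have : ∀ b : Fin (k + 2), (if b = 1 then w else 1) = 1 + (if b = 1 then w - 1 else 0) := by
      intro b; split_ifs <;> ring
    simp only [this, Finset.sum_add_distrib, Finset.sum_ite_eq', Finset.mem_univ, if_true]
    simp; ring
  have h1 : ∀ a : Fin (k + 2), ∑ b : Fin (k + 2), (if a ≠ b ∧ a ≠ 1 then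
      (if a = 0 then z else 1) * (if b = 1 then w else 1) else 0)
      = (1 + (if a = 0 then z - 1 else 0) - (if a = 1 then 1 else 0)) * (k + w) := by
    intro a
    by_cases h : a = 1
    · subst h; simp
    · have : ∀ b : Fin (k + 2), (if a ≠ b ∧ a ≠ 1 then
        (if a = 0 then z else 1) * (if b = 1 then w else 1) else 0)
        = (if a = 0 then z else 1) * ((if b = 1 then w else 1) - (if b = a then 1 else 0)) := by
        intro b
        by_cases hb : b = a
        · subst hb; simp [h]
        · simp [h, hb, Ne.symm hb]
      simp only [this, ← Finset.mul_sum, Finset.sum_sub_distrib, hb, Finset.sum_ite_eq', Finset.mem_univ, if_true, h, if_false]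
      split_ifs <;> ring
  simp only [h1, ← Finset.sum_mul, Finset.sum_sub_distrib, Finset.sum_add_distrib, Finset.sum_ite_eq', Finset.mem_univ, if_true]
  simp; left; ring

/-- The contribution of the partitions whose last number is in a block of its own. -/
noncomputable def DD (z w : ℂ) (n k : ℕ) : ℂ :=
  ∑ g : Fin n × Bool → Fin (k + 2), ∑ a : Fin (k + 2),
    if IsDoubleSignedPartition (n + 1) k (extF g a a) then wt z w (n + 1) k (extF g a a) else 0

lemma TT_succ (z w : ℂ) (n k : ℕ) :
    TT z w (n + 1) k = DD z w n k + ((k : ℂ) + z) * (k + w) * TT z w n k := by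
  rw [← sum_ab, TT, ← (extEquiv n (Fin (k + 2))).sum_comp, Fintype.sum_prod_type, DD, TT,
    Finset.mul_sum, ← Finset.sum_add_distrib]
  refine Finset.sum_congr rfl fun g _ => ?_
  rw [Fintype.sum_prod_type, Finset.sum_mul, ← Finset.sum_add_distrib]
  refine Finset.sum_congr rfl fun a _ => ?_
  rw [Finset.sum_mul]
  simp only [extEquiv, Equiv.coe_fn_mk]
  have : ∀ b : Fin (k + 2), (if IsDoubleSignedPartition (n + 1) k (extF g a b) then
        wt z w (n + 1) k (extF g a b) else 0) =
      (if a = b then (if IsDoubleSignedPartition (n + 1) k (extF g a a) then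
        wt z w (n + 1) k (extF g a a) else 0) else 0) +
      (if a ≠ b ∧ a ≠ 1 then
      (if a = 0 then z else 1) * (if b = 1 then w else 1) else 0) *
      (if IsDoubleSignedPartition n k g then wt z w n k g else 0) := by
    intro b
    by_cases h : a = b
    · subst h; simp
    · by_cases h1 : a = 1
      · simp only [part_ext_ne n k g a b h]
        rw [if_neg (fun q => q.2 h1), if_neg h, if_neg (fun q => q.2 h1)]
        ring
      · by_cases hg : IsDoubleSignedPartition n k g
        · simp only [part_ext_ne n k g a b h, wt_ext]
          have hc : a ≠ b ∧ a ≠ 1 := ⟨h, h1⟩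
          have hd : IsDoubleSignedPartition n k g ∧ a ≠ 1 := ⟨hg, h1⟩
          rw [if_pos hd, if_neg h, if_pos hc, if_pos hg]
          ring
        · simp only [part_ext_ne n k g a b h]
          simp [h, hg]
  refine (Finset.sum_congr rfl fun b _ => this b).trans ?_
  rw [Finset.sum_add_distrib, Finset.sum_ite_eq, if_pos (Finset.mem_univ _)]

lemma DD_zero (z w : ℂ) (n : ℕ) : DD z w n 0 = 0 := by
  refine Finset.sum_eq_zero fun g _ => Finset.sum_eq_zero fun a _ => ?_
  rw [if_neg]
  intro h
  obtain ⟨h1, h2, h3, -⟩ := part_ext_eq _ _ _ _ h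
  exact h3 h1

lemma DD_succ (z w : ℂ) (n k : ℕ) : DD z w n (k + 1) = TT z w n k := by
  have e : DD z w n (k + 1) = ∑ g : Fin n × Bool → Fin (k + 3),
      if IsDoubleSignedPartition (n + 1) (k + 1) (extF g (Fin.last (k + 2)) (Fin.last (k + 2))) then
        wt z w (n + 1) (k + 1) (extF g (Fin.last (k + 2)) (Fin.last (k + 2))) else 0 := by
    refine Finset.sum_congr rfl fun g _ => ?_
    rw [Finset.sum_eq_single (Fin.last (k + 2))]
    · intro a _ ha
      rw [if_neg]
      intro h
      exact ha (part_ext_eq _ _ _ _ h).1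
    · simp
  rw [e, TT]
  symm
  refine Finset.sum_of_injOn (fun (g : Fin n × Bool → Fin (k + 2)) p => (g p).castSucc) ?_ ?_ ?_ ?_
  · intro g _ g' _ h
    funext p
    exact Fin.castSucc_injective _ (congrFun h p)
  · intro g _; simp
  · intro g _ hg
    rw [if_neg]
    intro h
    have h' := (part_ext_eq _ _ _ _ h).2.2.2
    apply hg
    refine ⟨fun p => (g p).castPred (h' p), by simp, ?_⟩
    funext p
    simp
  · intro g _
    simp only [part_ext_last]
    congr 1
    have l0 : (Fin.last (k + 2) : Fin (k + 3)) ≠ 0 := by simp [Fin.ext_iff]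
    have l1 : (Fin.last (k + 2) : Fin (k + 3)) ≠ 1 := by simp [Fin.ext_iff]
    rw [wt_ext, wt_eq, wt_eq, if_neg l0, if_neg l1]
    simp only [cs0, cs1, mul_one]

lemma TT_zero_zero (z w : ℂ) : TT z w 0 0 = 1 := by
  have : ∀ f : Fin 0 × Bool → Fin 2, IsDoubleSignedPartition 0 0 f := by
    intro f
    refine ⟨fun a => a.elim0, fun a => a.elim0, fun j h0 h1 => ?_, fun _ _ _ a => a.elim0,
      fun _ _ _ _ _ _ _ a => a.elim0⟩
    exfalso
    fin_cases j
    · exact h0 rfl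
    · exact h1 rfl
  simp [TT, this, wt_eq]

lemma TT_zero_succ (z w : ℂ) (k : ℕ) : TT z w 0 (k + 1) = 0 := by
  refine Finset.sum_eq_zero fun f _ => ?_
  rw [if_neg]
  rintro ⟨-, -, h, -⟩
  obtain ⟨m, -⟩ := h (Fin.last _) (by simp [Fin.ext_iff]) (by simp [Fin.ext_iff])
  exact m.elim0

lemma TT_gt (z w : ℂ) (n : ℕ) : ∀ k, n < k → TT z w n k = 0 := by
  induction n with
  | zero =>
    intro k hk
    obtain ⟨k, rfl⟩ := Nat.exists_eq_succ_of_ne_zero hk.ne'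
    exact TT_zero_succ z w k
  | succ n ih =>
    intro k hk
    obtain ⟨k, rfl⟩ := Nat.exists_eq_succ_of_ne_zero (by omega : k ≠ 0)
    rw [TT_succ, DD_succ, ih k (by omega), ih (k + 1) (by omega)]
    simp

lemma zwPoly_succ (z w : ℂ) (k : ℕ) : zwPoly z w (k + 1) =
    zwPoly z w k * (Polynomial.X - Polynomial.C (((k : ℂ) + z) * ((k : ℂ) + w))) := by
  simp [zwPoly, Finset.prod_range_succ]

lemma X_pow_TT (z w : ℂ) (n : ℕ) : (Polynomial.X : Polynomial ℂ) ^ n =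
    ∑ k ∈ Finset.range (n + 1), Polynomial.C (TT z w n k) * zwPoly z w k := by
  induction n with
  | zero => simp [TT_zero_zero, zwPoly]
  | succ n ih =>
    have h1 : ∑ k ∈ Finset.range (n + 1 + 1), Polynomial.C (TT z w (n + 1) k) * zwPoly z w k =
        ∑ k ∈ Finset.range (n + 1 + 1), Polynomial.C (DD z w n k) * zwPoly z w k +
        ∑ k ∈ Finset.range (n + 1 + 1),
          Polynomial.C (((k : ℂ) + z) * (k + w) * TT z w n k) * zwPoly z w k := by
      rw [← Finset.sum_add_distrib]
      refine Finset.sum_congr rfl fun k _ => ?_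
      rw [TT_succ, Polynomial.C_add, add_mul]
    rw [h1, Finset.sum_range_succ', DD_zero, Finset.sum_range_succ _ (n + 1),
      TT_gt z w n (n + 1) (by omega), pow_succ, ih, Finset.sum_mul]
    simp only [Polynomial.C_0, mul_zero, zero_mul, add_zero]
    rw [← Finset.sum_add_distrib]
    refine Finset.sum_congr rfl fun k _ => ?_
    rw [DD_succ, zwPoly_succ, Polynomial.C_mul (a := ((k : ℂ) + z) * (k + w))]
    ring

lemma zwPoly_monic (z w : ℂ) (k : ℕ) : (zwPoly z w k).Monic :=
  Polynomial.monic_prod_of_monic _ _ fun _ _ => Polynomial.monic_X_sub_C _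

lemma zwPoly_natDegree (z w : ℂ) (k : ℕ) : (zwPoly z w k).natDegree = k := by
  rw [zwPoly, Polynomial.natDegree_prod_of_monic _ _ fun _ _ => Polynomial.monic_X_sub_C _]
  simp only [Polynomial.natDegree_X_sub_C]
  simp

lemma zw_unique (z w : ℂ) (c : ℕ → ℂ) (m : ℕ)
    (h : ∑ k ∈ Finset.range m, Polynomial.C (c k) * zwPoly z w k = 0) : ∀ k < m, c k = 0 := by
  induction m with
  | zero => intro k hk; omega
  | succ m ih =>
    have hm : c m = 0 := by
      have h2 := congrArg (fun p => Polynomial.coeff p m) h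
      simp only [Polynomial.finsetSum_coeff, Polynomial.coeff_C_mul, Polynomial.coeff_zero] at h2
      rw [Finset.sum_range_succ, Finset.sum_eq_zero, zero_add] at h2
      · have := (zwPoly_monic z w m).coeff_natDegree
        rw [zwPoly_natDegree] at this
        simpa [this] using h2
      · intro k hk
        rw [Polynomial.coeff_eq_zero_of_natDegree_lt, mul_zero]
        rw [zwPoly_natDegree]; exact Finset.mem_range.1 hk
    rw [Finset.sum_range_succ, hm] at h
    simp only [Polynomial.C_0, zero_mul, add_zero] at h
    intro k hk
    rcases Nat.lt_succ_iff_lt_or_eq.1 hk with h' | rfl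
    · exact ih h k h'
    · exact hm

/-- Theorem 2.12 of the paper: `S_{z,w}(n,k)` is the generating
polynomial of the double signed `k`-partitions of `[n]₂`, with `z` marking the
subscript-1 elements of `B₀` and `w` marking the subscript-2 elements of `B₀'`. -/
theorem statement17 (z w : ℂ) (S : ℕ → ℕ → ℂ)
    (hS : ∀ m : ℕ, (Polynomial.X : Polynomial ℂ) ^ m =
      ∑ k ∈ Finset.range (m + 1), Polynomial.C (S m k) * zwPoly z w k) :
    ∀ n k : ℕ, k ≤ n →
      S n k =
        ∑ f ∈ Finset.univ.filter (fun f : Fin n × Bool → Fin (k + 2) =>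
            IsDoubleSignedPartition n k f),
          z ^ sStat n k f * w ^ tStat n k f := by
  intro n k hk
  have h := zw_unique z w (fun k => S n k - TT z w n k) (n + 1) (by
    simp only [Polynomial.C_sub, sub_mul, Finset.sum_sub_distrib]
    rw [← hS, ← X_pow_TT, sub_self]) k (by omega)
  rw [sub_eq_zero.1 h, TT, Finset.sum_filter]
  rfl
end
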